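/- arXiv:1706.03890 — 6 statements merged into one kernel-verified Lean document; each statement's English description precedes it below -/
import Mathlib

section
/- Under hypothesis (H.1) there is a constant C > 0 (depending only on φ, λ, α, β) such that for all reals 0 < s ≤ t one has |(t+s)^{2β} φ(1) + t^{2β} φ(1) − 2 t^{2β} φ((t+s)/t) − 2 λ t^{2β−α} s^{α}| ≤ C s t^{2β−1}. (The left-hand expression equals |E[(X_{t+s} − X_t)^2] − 2 λ t^{2β−α} s^{α}| for the centered β-self-similar Gaussian process X with covariance R.) -/
open Real Filter Finset Topology

/-- The covariance function `R(s,t)` of the centered `β`-self-similar Gaussian process: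
`R(s,t) = s^{2β} φ(t/s)` for `0 < s ≤ t`, symmetric, and `0` if `s = 0` or `t = 0`. -/
noncomputable def Rcov (β : ℝ) (φ : ℝ → ℝ) (s t : ℝ) : ℝ :=
  if s = 0 ∨ t = 0 then 0
  else if s ≤ t then s ^ (2 * β) * φ (t / s)
  else t ^ (2 * β) * φ (s / t)

/-- `Dn β φ n j k = E[(X_{(j+1)/n} - X_{j/n})(X_{(k+1)/n} - X_{k/n})]`, expressed via `R`. -/
noncomputable def Dn (β : ℝ) (φ : ℝ → ℝ) (n j k : ℕ) : ℝ :=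
  Rcov β φ (((j : ℝ) + 1) / n) (((k : ℝ) + 1) / n)
    - Rcov β φ (((j : ℝ) + 1) / n) ((k : ℝ) / n)
    - Rcov β φ ((j : ℝ) / n) (((k : ℝ) + 1) / n)
    + Rcov β φ ((j : ℝ) / n) ((k : ℝ) / n)

/-- A function that is continuous on `[1, ∞)` and differentiable on `(1, ∞)`, and whose sum with
`c * (x - 1) ^ α` has derivative bounded by `M` on `(1, 2]`, satisfies a Lipschitz-type bound
at `1`. -/
theorem abs_add_mul_rpow_sub_le {α c M : ℝ} {φ : ℝ → ℝ} (hα : 0 < α)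
    (hφc : ContinuousOn φ (Set.Ici 1)) (hφd : DifferentiableOn ℝ φ (Set.Ioi 1))
    (hM : ∀ x ∈ Set.Ioc (1 : ℝ) 2, |deriv (fun y => φ y + c * (y - 1) ^ α) x| ≤ M)
    {u : ℝ} (hu : 0 < u) (hu1 : u ≤ 1) :
    |φ (1 + u) + c * u ^ α - φ 1| ≤ M * u := by
  have hlt : (1 : ℝ) < 1 + u := by linarith
  have hcont : ContinuousOn (fun y => φ y + c * (y - 1) ^ α) (Set.Icc 1 (1 + u)) := by
    refine (hφc.mono Set.Icc_subset_Ici_self).add (Continuous.continuousOn ?_)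
    exact continuous_const.mul
      ((continuous_id.sub continuous_const).rpow_const fun _ => Or.inr hα.le)
  have hdiff : DifferentiableOn ℝ (fun y => φ y + c * (y - 1) ^ α) (Set.Ioo 1 (1 + u)) := by
    intro x hx
    have hx1 : x - 1 ≠ 0 := (sub_pos.2 hx.1).ne'
    refine DifferentiableAt.differentiableWithinAt ?_
    exact (hφd.differentiableAt (Ioi_mem_nhds hx.1)).add
      (((differentiableAt_id.sub_const 1).rpow_const (Or.inl hx1)).const_mul c)
  obtain ⟨x, hx, hslope⟩ := exists_deriv_eq_slope _ hlt hcont hdiff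
  have hbound := hM x ⟨hx.1, by linarith [hx.2]⟩
  rw [hslope, abs_div] at hbound
  simpa [abs_of_pos hu, div_le_iff₀ hu, Real.zero_rpow hα.ne'] using hbound

theorem stmt_0 (α β lam : ℝ) (φ : ℝ → ℝ)
    (hα : 0 < α) (hα1 : α < 1) (hβ : 0 < β) (hβ2 : β ≤ 1 / 2) (hαβ : α ≤ 2 * β)
    (hφc : ContinuousOn φ (Set.Ici 1)) (hφ2 : ContDiffOn ℝ 2 φ (Set.Ioi 1))
    (hlam : 0 < lam)
    (hH1 : ∃ M : ℝ, ∀ x ∈ Set.Ioc (1 : ℝ) 2,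
      |deriv (fun y => φ y + lam * (y - 1) ^ α) x| ≤ M)
    :
    ∃ C : ℝ, 0 < C ∧ ∀ s t : ℝ, 0 < s → s ≤ t →
      |(t + s) ^ (2 * β) * φ 1 + t ^ (2 * β) * φ 1
          - 2 * t ^ (2 * β) * φ ((t + s) / t) - 2 * lam * t ^ (2 * β - α) * s ^ α|
        ≤ C * s * t ^ (2 * β - 1) := by
  obtain ⟨M, hM⟩ := hH1
  have hM0 : 0 ≤ M := (abs_nonneg _).trans (hM 2 ⟨by norm_num, le_rfl⟩)
  refine ⟨|φ 1| + 2 * M + 1, by positivity, fun s t hs hst => ?_⟩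
  have ht : 0 < t := hs.trans_le hst
  obtain ⟨u, rfl⟩ : ∃ u, s = t * u := ⟨s / t, by field_simp⟩
  have hu : 0 < u := pos_of_mul_pos_right hs ht.le
  have hu1 : u ≤ 1 := by nlinarith
  have hψ := abs_add_mul_rpow_sub_le hα hφc (hφ2.differentiableOn (by norm_num)) hM hu hu1
  have hpow_le : (1 + u) ^ (2 * β) ≤ 1 + u := by
    simpa using Real.rpow_le_rpow_of_exponent_le (x := 1 + u) (by linarith)
      (show 2 * β ≤ 1 by linarith)
  have hpow_ge : 1 ≤ (1 + u) ^ (2 * β) := Real.one_le_rpow (by linarith) (by positivity)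
  have hfirst : |((1 + u) ^ (2 * β) - 1) * φ 1| ≤ u * |φ 1| := by
    rw [abs_mul, abs_of_nonneg (by linarith)]
    gcongr
    linarith
  have hquot : (t + t * u) / t = 1 + u := by field_simp
  have hsum : (t + t * u) ^ (2 * β) = t ^ (2 * β) * (1 + u) ^ (2 * β) := by
    rw [← Real.mul_rpow ht.le (by linarith)]
    ring_nf
  have hscale : t ^ (2 * β - α) * (t * u) ^ α = t ^ (2 * β) * u ^ α := by
    rw [Real.mul_rpow ht.le hu.le, ← mul_assoc, ← Real.rpow_add ht, sub_add_cancel]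
  have hright : t * t ^ (2 * β - 1) = t ^ (2 * β) := by
    rw [Real.rpow_sub_one ht.ne', mul_div_cancel₀ _ ht.ne']
  have hT : 0 < t ^ (2 * β) := Real.rpow_pos_of_pos ht _
  rw [hquot, hsum]
  calc _ = |t ^ (2 * β) * (((1 + u) ^ (2 * β) - 1) * φ 1
          - 2 * (φ (1 + u) + lam * u ^ α - φ 1))| := by
        congr 1
        linear_combination (-2 * lam) * hscale
    _ = t ^ (2 * β) * |((1 + u) ^ (2 * β) - 1) * φ 1
          - 2 * (φ (1 + u) + lam * u ^ α - φ 1)| := by rw [abs_mul, abs_of_pos hT]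
    _ ≤ t ^ (2 * β) * ((|φ 1| + 2 * M + 1) * u) := by
        gcongr
        refine (abs_sub _ _).trans ?_
        rw [abs_mul 2, abs_two]
        linarith
    _ = (|φ 1| + 2 * M + 1) * (t * u) * t ^ (2 * β - 1) := by
        linear_combination (-(|φ 1| + 2 * M + 1) * u) * hright
end

section
/- Under hypothesis (H.1) there is a constant C > 0 (depending only on φ, λ, α, β) such that for all reals 0 < s ≤ t one has (t+s)^{2β} φ(1) + t^{2β} φ(1) − 2 t^{2β} φ((t+s)/t) ≤ C s^{α} t^{2β−α}. (Equivalently, E[(X_{t+s} − X_t)^2] ≤ C s^{α} t^{2β−α} for the process X with covariance R.) -/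
open Real Filter Finset Topology

/-- A function continuous on `[a, b]` whose derivative is bounded by `M` on `(a, b)` is
`M`-Lipschitz between the endpoints. -/
theorem abs_sub_le_of_abs_deriv_le {f : ℝ → ℝ} {a b M : ℝ} (hab : a < b)
    (hc : ContinuousOn f (Set.Icc a b)) (hd : DifferentiableOn ℝ f (Set.Ioo a b))
    (hM : ∀ x ∈ Set.Ioo a b, |deriv f x| ≤ M) : |f b - f a| ≤ M * (b - a) := by
  obtain ⟨c, hc', h⟩ := exists_deriv_eq_slope f hab hc hd
  have hba : 0 < b - a := sub_pos.2 hab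
  have := hM c hc'
  rwa [h, abs_div, abs_of_pos hba, div_le_iff₀ hba] at this

theorem stmt_1 (α β lam : ℝ) (φ : ℝ → ℝ)
    (hα : 0 < α) (hα1 : α < 1) (hβ : 0 < β) (hβ2 : β ≤ 1 / 2) (hαβ : α ≤ 2 * β)
    (hφc : ContinuousOn φ (Set.Ici 1)) (hφ2 : ContDiffOn ℝ 2 φ (Set.Ioi 1))
    (hlam : 0 < lam)
    (hH1 : ∃ M : ℝ, ∀ x ∈ Set.Ioc (1 : ℝ) 2,
      |deriv (fun y => φ y + lam * (y - 1) ^ α) x| ≤ M)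
    :
    ∃ C : ℝ, 0 < C ∧ ∀ s t : ℝ, 0 < s → s ≤ t →
      (t + s) ^ (2 * β) * φ 1 + t ^ (2 * β) * φ 1 - 2 * t ^ (2 * β) * φ ((t + s) / t)
        ≤ C * s ^ α * t ^ (2 * β - α) := by
  obtain ⟨M, hM⟩ := hH1
  have hM0 : 0 ≤ M := (abs_nonneg _).trans (hM 2 (by norm_num))
  have key : ∀ x : ℝ, 0 < x → x ≤ 1 →
      (1 + x) ^ (2 * β) * φ 1 + φ 1 - 2 * φ (1 + x) ≤ (|φ 1| + 2 * M + 2 * lam) * x ^ α := by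
    intro x hx hx1
    have hψ := abs_sub_le_of_abs_deriv_le (f := fun y => φ y + lam * (y - 1) ^ α)
      (a := 1) (b := 1 + x) (M := M) (by linarith)
      ((hφc.mono Set.Icc_subset_Ici_self).add (continuousOn_const.mul
        ((continuousOn_id.sub continuousOn_const).rpow_const fun _ _ => Or.inr hα.le)))
      (fun y hy => (((hφ2.differentiableOn (by norm_num)).differentiableAt
        (Ioi_mem_nhds hy.1)).add (((differentiableAt_id.sub_const 1).rpow_const
          (Or.inl (sub_pos.2 hy.1).ne')).const_mul lam)).differentiableWithinAt)
      (fun y hy => hM y ⟨hy.1, by linarith [hy.2]⟩)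
    simp only [sub_self, zero_rpow hα.ne', mul_zero, add_zero, add_sub_cancel_left] at hψ
    have hle : x ≤ x ^ α := by
      simpa using rpow_le_rpow_of_exponent_ge hx hx1 hα1.le
    have hlo : 1 ≤ (1 + x) ^ (2 * β) := one_le_rpow (by linarith) (by linarith)
    have hhi : (1 + x) ^ (2 * β) ≤ 1 + x := by
      simpa using rpow_le_rpow_of_exponent_le (x := 1 + x) (by linarith)
        (show 2 * β ≤ 1 by linarith)
    have hφ1 : ((1 + x) ^ (2 * β) - 1) * φ 1 ≤ x ^ α * |φ 1| :=
      (mul_le_mul_of_nonneg_left (le_abs_self _) (by linarith)).trans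
        (mul_le_mul_of_nonneg_right (by linarith) (abs_nonneg _))
    have hMx : M * x ≤ M * x ^ α := mul_le_mul_of_nonneg_left hle hM0
    linarith [(abs_le.1 hψ).1]
  refine ⟨|φ 1| + 2 * M + 2 * lam, by positivity, fun s t hs hst => ?_⟩
  have ht : 0 < t := hs.trans_le hst
  have h := mul_le_mul_of_nonneg_left (key (s / t) (div_pos hs ht) ((div_le_one ht).2 hst))
    (rpow_nonneg ht.le (2 * β))
  have hts : t * (1 + s / t) = t + s := by field_simp
  have hdiv : (t + s) / t = 1 + s / t := by field_simp
  have hpow : (t + s) ^ (2 * β) = t ^ (2 * β) * (1 + s / t) ^ (2 * β) := by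
    rw [← mul_rpow ht.le (by positivity), hts]
  have hscale : t ^ (2 * β) * (s / t) ^ α = s ^ α * t ^ (2 * β - α) := by
    rw [div_rpow hs.le ht.le, rpow_sub ht]
    ring
  rw [hdiv, hpow, mul_assoc _ (s ^ α), ← hscale]
  linarith
end

section
/- Assume hypotheses (H.1) and (H.2) hold with α = 1/(2ℓ+1) for an integer ℓ ≥ 1, and assume D_n(j,j) ≥ 0 for all n, j. Fix an integer 0 ≤ r ≤ ℓ − 1, set q_r = 2(ℓ−r)+1, and define G_n(j,k) = D_n(j,j)^{r} D_n(k,k)^{r} D_n(j,k)^{q_r}. Then for all reals 0 < s₁ < t₁ < s₂ < t₂, the double sum over j = ⌊ns₁⌋, …, ⌊nt₁⌋ − 1 and k = ⌊ns₂⌋, …, ⌊nt₂⌋ − 1 of |G_n(j,k)| tends to 0 as n → ∞. -/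
open Real Filter Finset Topology

/-- On a square bounded away from the axes the covariance is bounded. -/
theorem Rcov_bounded {β : ℝ} {φ : ℝ → ℝ} (hβ : 0 < β) (hφ : ContinuousOn φ (Set.Ici 1))
    {c T : ℝ} (hc : 0 < c) :
    ∃ B : ℝ, 0 ≤ B ∧ ∀ s ∈ Set.Icc c T, ∀ t ∈ Set.Icc c T, |Rcov β φ s t| ≤ B := by
  obtain ⟨P, hP⟩ := isCompact_Icc.exists_bound_of_continuousOn
    (hφ.mono (Set.Icc_subset_Ici_self : Set.Icc 1 (T / c) ⊆ _))
  have key : ∀ s ∈ Set.Icc c T, ∀ t ∈ Set.Icc c T, s ≤ t →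
      |s ^ (2 * β) * φ (t / s)| ≤ T ^ (2 * β) * |P| := by
    intro s hs t ht hst
    have hs0 : 0 < s := hc.trans_le hs.1
    rw [abs_mul, abs_of_nonneg (rpow_nonneg hs0.le _)]
    have h1 : |φ (t / s)| ≤ |P| := by
      refine (hP (t / s) ⟨(one_le_div hs0).2 hst, ?_⟩).trans (le_abs_self P)
      exact div_le_div₀ (hs0.le.trans hs.2) ht.2 hc hs.1
    exact mul_le_mul (rpow_le_rpow hs0.le hs.2 (by positivity)) h1 (abs_nonneg _)
      (rpow_nonneg (hs0.le.trans hs.2) _)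
  refine ⟨|T ^ (2 * β)| * |P|, by positivity, fun s hs t ht => ?_⟩
  have hs0 : s ≠ 0 := (hc.trans_le hs.1).ne'
  have ht0 : t ≠ 0 := (hc.trans_le ht.1).ne'
  have hT : T ^ (2 * β) * |P| ≤ |T ^ (2 * β)| * |P| :=
    mul_le_mul_of_nonneg_right (le_abs_self _) (abs_nonneg _)
  unfold Rcov
  rw [if_neg (by tauto)]
  split_ifs with h
  · exact (key s hs t ht h).trans hT
  · exact (key t ht s hs (not_le.1 h).le).trans hT

/-- Away from the diagonal the covariance is Lipschitz in its larger argument. -/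
theorem Rcov_lipschitz_of_lt {β : ℝ} {φ : ℝ → ℝ} (hβ : 0 < β)
    (hφ : ContDiffOn ℝ 2 φ (Set.Ioi 1)) {c d m T : ℝ} (hc : 0 < c) (hd : 0 < d) (hdm : d < m) :
    ∃ K : ℝ, 0 ≤ K ∧ ∀ s ∈ Set.Icc c d, ∀ t ∈ Set.Icc m T, ∀ t' ∈ Set.Icc m T,
      |Rcov β φ s t' - Rcov β φ s t| ≤ K * |t' - t| := by
  have hsub : Set.Icc (m / d) (T / c) ⊆ Set.Ioi 1 := fun x hx =>
    ((one_lt_div hd).2 hdm).trans_le hx.1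
  obtain ⟨L, hL⟩ := (hφ.mono hsub).exists_lipschitzOnWith (by norm_num)
    (convex_Icc _ _) isCompact_Icc
  refine ⟨d ^ (2 * β) * (L / c), by positivity, fun s hs t ht t' ht' => ?_⟩
  have hs0 : 0 < s := hc.trans_le hs.1
  have hR : ∀ u ∈ Set.Icc m T, Rcov β φ s u = s ^ (2 * β) * φ (u / s) := by
    intro u hu
    have hsu : s < u := hs.2.trans_lt (hdm.trans_le hu.1)
    unfold Rcov
    rw [if_neg (by simp [hs0.ne', (hs0.trans hsu).ne']), if_pos hsu.le]
  have hmem : ∀ u ∈ Set.Icc m T, u / s ∈ Set.Icc (m / d) (T / c) := by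
    intro u hu
    have hu0 : 0 < u := hd.trans (hdm.trans_le hu.1)
    exact ⟨div_le_div₀ hu0.le hu.1 hs0 hs.2, div_le_div₀ (hu0.le.trans hu.2) hu.2 hc hs.1⟩
  have hlip := hL.dist_le_mul _ (hmem t' ht') _ (hmem t ht)
  rw [Real.dist_eq, Real.dist_eq, ← sub_div, abs_div, abs_of_pos hs0] at hlip
  rw [hR t ht, hR t' ht', ← mul_sub, abs_mul, abs_of_nonneg (rpow_nonneg hs0.le _), mul_assoc]
  refine mul_le_mul (rpow_le_rpow hs0.le hs.2 (by positivity)) ?_ (abs_nonneg _) (by positivity)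
  calc |φ (t' / s) - φ (t / s)| ≤ L * (|t' - t| / s) := hlip
    _ ≤ L * (|t' - t| / c) := by gcongr; exact hs.1
    _ = L / c * |t' - t| := by ring

/-- Grid points `i / n` and `(i + 1) / n` with `i` between the floors of `n * a` and `n * b` lie in
`[a', b]` as soon as `1 / n ≤ a - a'`. -/
theorem grid_mem_Icc {n i : ℕ} {a a' b : ℝ} (hn : 0 < n) (hb : 0 ≤ b)
    (han : 1 / (n : ℝ) ≤ a - a') (hi : i ∈ Finset.Ico ⌊(n : ℝ) * a⌋₊ ⌊(n : ℝ) * b⌋₊) :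
    (i : ℝ) / n ∈ Set.Icc a' b ∧ ((i : ℝ) + 1) / n ∈ Set.Icc a' b := by
  have hn0 : (0 : ℝ) < n := by exact_mod_cast hn
  rw [Finset.mem_Ico] at hi
  have h1 : (n : ℝ) * a < i + 1 :=
    (Nat.lt_floor_add_one _).trans_le (by exact_mod_cast Nat.succ_le_succ hi.1)
  have h2 : (i : ℝ) + 1 ≤ n * b :=
    le_trans (by exact_mod_cast hi.2) (Nat.floor_le (by positivity))
  rw [div_le_iff₀ hn0] at han
  refine ⟨⟨?_, ?_⟩, ⟨?_, ?_⟩⟩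
  · rw [le_div_iff₀ hn0]; linarith
  · rw [div_le_iff₀ hn0]; linarith
  · rw [le_div_iff₀ hn0]; linarith
  · rw [div_le_iff₀ hn0]; linarith

theorem stmt_10 (α β lam ν C₁ C₂ : ℝ) (φ : ℝ → ℝ) (ℓ r : ℕ) (hℓ : 1 ≤ ℓ)
    (hαℓ : α = 1 / (2 * (ℓ : ℝ) + 1)) (hr : r < ℓ)
    (hα : 0 < α) (hα1 : α < 1) (hβ : 0 < β) (hβ2 : β ≤ 1 / 2) (hαβ : α ≤ 2 * β)
    (hφc : ContinuousOn φ (Set.Ici 1)) (hφ2 : ContDiffOn ℝ 2 φ (Set.Ioi 1))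
    (hlam : 0 < lam)
    (hH1 : ∃ M : ℝ, ∀ x ∈ Set.Ioc (1 : ℝ) 2,
      |deriv (fun y => φ y + lam * (y - 1) ^ α) x| ≤ M)
    (hC₁ : 0 < C₁) (hC₂ : 0 < C₂) (hν : 1 < ν) (hν2 : ν ≤ 2)
    (hH2a : ∀ x ∈ Set.Ioc (1 : ℝ) 2, |iteratedDeriv 2 φ x| ≤ C₁ * (x - 1) ^ (α - 2))
    (hH2b : ∀ x ∈ Set.Ioi (2 : ℝ), |iteratedDeriv 2 φ x| ≤ C₂ * x ^ (-ν - 1))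
    (hpos : ∀ n j : ℕ, 0 ≤ Dn β φ n j j) :
    ∀ s₁ t₁ s₂ t₂ : ℝ, 0 < s₁ → s₁ < t₁ → t₁ < s₂ → s₂ < t₂ →
      Filter.Tendsto (fun n : ℕ =>
          ∑ j ∈ Finset.Ico ⌊(n : ℝ) * s₁⌋₊ ⌊(n : ℝ) * t₁⌋₊,
            ∑ k ∈ Finset.Ico ⌊(n : ℝ) * s₂⌋₊ ⌊(n : ℝ) * t₂⌋₊,
              |(Dn β φ n j j) ^ r * (Dn β φ n k k) ^ r * (Dn β φ n j k) ^ (2 * (ℓ - r) + 1)|)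
        Filter.atTop (nhds 0) := by
  intro s₁ t₁ s₂ t₂ hs₁ hst₁ hts hst₂
  have ht₁ : 0 < t₁ := hs₁.trans hst₁
  have ht₂ : 0 < t₂ := (ht₁.trans hts).trans hst₂
  set c := s₁ / 2 with hc
  set m := (t₁ + s₂) / 2 with hm
  obtain ⟨B, hB0, hB⟩ := Rcov_bounded (T := t₂) hβ hφc (show 0 < c by positivity)
  obtain ⟨K, hK0, hK⟩ := Rcov_lipschitz_of_lt (T := t₂) hβ hφ2 (show 0 < c by positivity) ht₁
    (show t₁ < m by linarith)
  set q := 2 * (ℓ - r) + 1 with hq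
  have hq3 : 3 ≤ q := by omega
  have hlim : Tendsto (fun n : ℕ =>
      t₁ * t₂ * ((4 * B) ^ r * (4 * B) ^ r * (2 * K) ^ q) * (1 / (n : ℝ))) atTop (𝓝 0) := by
    simpa using tendsto_one_div_atTop_nhds_zero_nat.const_mul
      (t₁ * t₂ * ((4 * B) ^ r * (4 * B) ^ r * (2 * K) ^ q))
  have hev : ∀ ε : ℝ, 0 < ε → ∀ᶠ n : ℕ in atTop, 1 / (n : ℝ) ≤ ε := fun ε hε =>
    (tendsto_one_div_atTop_nhds_zero_nat.eventually (gt_mem_nhds hε)).mono fun _ h => h.le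
  refine tendsto_of_tendsto_of_tendsto_of_le_of_le' tendsto_const_nhds hlim
    (Eventually.of_forall fun n => by positivity) ?_
  filter_upwards [eventually_gt_atTop 0, hev (s₁ - c) (by linarith), hev (s₂ - m) (by linarith)]
    with n hn hn₁ hn₂
  have hn0 : (0 : ℝ) < n := by exact_mod_cast hn
  have hn1 : (1 : ℝ) ≤ n := by exact_mod_cast hn
  have hdiag : ∀ i : ℕ, (i : ℝ) / n ∈ Set.Icc c t₂ → ((i : ℝ) + 1) / n ∈ Set.Icc c t₂ →
      |Dn β φ n i i| ≤ 4 * B := by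
    intro i h h'
    have h1 := abs_le.1 (hB _ h _ h)
    have h2 := abs_le.1 (hB _ h _ h')
    have h3 := abs_le.1 (hB _ h' _ h)
    have h4 := abs_le.1 (hB _ h' _ h')
    unfold Dn
    exact abs_le.2 ⟨by linarith, by linarith⟩
  have hterm : ∀ j ∈ Finset.Ico ⌊(n : ℝ) * s₁⌋₊ ⌊(n : ℝ) * t₁⌋₊,
      ∀ k ∈ Finset.Ico ⌊(n : ℝ) * s₂⌋₊ ⌊(n : ℝ) * t₂⌋₊,
      |(Dn β φ n j j) ^ r * (Dn β φ n k k) ^ r * (Dn β φ n j k) ^ q| ≤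
        (4 * B) ^ r * (4 * B) ^ r * ((2 * K) ^ q * (1 / (n : ℝ)) ^ 3) := by
    intro j hj k hk
    obtain ⟨hj1, hj2⟩ := grid_mem_Icc hn ht₁.le hn₁ hj
    obtain ⟨hk1, hk2⟩ := grid_mem_Icc hn ht₂.le hn₂ hk
    have hjT : Set.Icc c t₁ ⊆ Set.Icc c t₂ := Set.Icc_subset_Icc_right (by linarith)
    have hkT : Set.Icc m t₂ ⊆ Set.Icc c t₂ := Set.Icc_subset_Icc_left (by linarith)
    have hoff : |Dn β φ n j k| ≤ 2 * K * (1 / n) := by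
      have hd : |((k : ℝ) + 1) / n - k / n| = 1 / n := by
        rw [← sub_div, add_sub_cancel_left, abs_of_pos (by positivity)]
      have h1 := abs_le.1 (hK _ hj1 _ hk1 _ hk2)
      have h2 := abs_le.1 (hK _ hj2 _ hk1 _ hk2)
      rw [hd] at h1 h2
      unfold Dn
      exact abs_le.2 ⟨by linarith, by linarith⟩
    rw [abs_mul, abs_mul, abs_pow, abs_pow, abs_pow]
    have hpow : |Dn β φ n j k| ^ q ≤ (2 * K) ^ q * (1 / (n : ℝ)) ^ 3 :=
      calc |Dn β φ n j k| ^ q ≤ (2 * K * (1 / n)) ^ q := by gcongr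
        _ = (2 * K) ^ q * (1 / (n : ℝ)) ^ q := mul_pow _ _ _
        _ ≤ (2 * K) ^ q * (1 / (n : ℝ)) ^ 3 := by
          refine mul_le_mul_of_nonneg_left ?_ (by positivity)
          exact pow_le_pow_of_le_one (by positivity) ((div_le_one hn0).2 hn1) hq3
    have hdj := hdiag j (hjT hj1) (hjT hj2)
    have hdk := hdiag k (hkT hk1) (hkT hk2)
    gcongr
  have hcard : ∀ a b : ℝ, 0 ≤ b →
      ((Finset.Ico ⌊(n : ℝ) * a⌋₊ ⌊(n : ℝ) * b⌋₊).card : ℝ) ≤ n * b := fun a b hb => by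
    rw [Nat.card_Ico]
    exact le_trans (by exact_mod_cast Nat.sub_le _ _) (Nat.floor_le (by positivity))
  calc _ ≤ ∑ j ∈ Finset.Ico ⌊(n : ℝ) * s₁⌋₊ ⌊(n : ℝ) * t₁⌋₊,
        ∑ k ∈ Finset.Ico ⌊(n : ℝ) * s₂⌋₊ ⌊(n : ℝ) * t₂⌋₊,
          (4 * B) ^ r * (4 * B) ^ r * ((2 * K) ^ q * (1 / (n : ℝ)) ^ 3) :=
        Finset.sum_le_sum fun j hj => Finset.sum_le_sum fun k hk => hterm j hj k hk
    _ ≤ (n * t₁) * ((n * t₂) *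
          ((4 * B) ^ r * (4 * B) ^ r * ((2 * K) ^ q * (1 / (n : ℝ)) ^ 3))) := by
        simp only [Finset.sum_const, nsmul_eq_mul]
        gcongr
        · exact hcard _ _ ht₁.le
        · exact hcard _ _ ht₂.le
    _ = _ := by field_simp
end

section
/- Assume hypotheses (H.1) and (H.2) hold with α = 1/(2ℓ+1) for an integer ℓ ≥ 1, and assume D_n(j,j) ≥ 0 for all n, j. Fix an integer 0 ≤ r ≤ ℓ − 1, set q_r = 2(ℓ−r)+1, and define G_n(j,k) = D_n(j,j)^{r} D_n(k,k)^{r} D_n(j,k)^{q_r}. Then for every t > 0 and every fixed integer x ≥ 0, the sum over j = 0, …, ⌊nt⌋ − 1 − x of G_n(j, j+x) converges as n → ∞ to (α/(2β)) · 2^{2ℓ+1−q_r} λ^{2ℓ+1} t^{2β/α} ρ_α(x)^{q_r}, where ρ_α(x) = |x+1|^{α} + |x−1|^{α} − 2|x|^{α}. -/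
open Real Filter Finset Topology

/-- `ρ_α(m) = |m+1|^α + |m-1|^α - 2|m|^α`. -/
noncomputable def rho (α : ℝ) (m : ℤ) : ℝ :=
  |(m : ℝ) + 1| ^ α + |(m : ℝ) - 1| ^ α - 2 * |(m : ℝ)| ^ α

lemma Rcov_comm (β : ℝ) (φ : ℝ → ℝ) (s t : ℝ) : Rcov β φ s t = Rcov β φ t s := by
  unfold Rcov
  rcases lt_trichotomy s t with h | h | h
  · simp [h.le, not_le.2 h, or_comm]
  · simp [h]
  · simp [h.le, not_le.2 h, or_comm]

lemma Rcov_div (β : ℝ) (φ : ℝ → ℝ) {s t c : ℝ} (hs : 0 ≤ s) (ht : 0 ≤ t) (hc : 0 < c) :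
    Rcov β φ (s / c) (t / c) = c ^ (-(2 * β)) * Rcov β φ s t := by
  unfold Rcov
  have h1 : s / c = 0 ↔ s = 0 := by simp [hc.ne']
  have h2 : t / c = 0 ↔ t = 0 := by simp [hc.ne']
  have h3 : s / c ≤ t / c ↔ s ≤ t := div_le_div_iff_of_pos_right hc
  simp only [h1, h2, h3]
  rw [div_div_div_cancel_right₀ hc.ne', div_div_div_cancel_right₀ hc.ne',
    Real.div_rpow hs hc.le, Real.div_rpow ht hc.le, Real.rpow_neg hc.le]
  split_ifs
  · simp
  · ring
  · ring

lemma Dn_eq_rpow_mul (β : ℝ) (φ : ℝ → ℝ) {n : ℕ} (hn : 0 < n) (j k : ℕ) :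
    Dn β φ n j k = (n : ℝ) ^ (-(2 * β)) * Dn β φ 1 j k := by
  have hn' : (0 : ℝ) < n := by exact_mod_cast hn
  unfold Dn
  rw [Rcov_div β φ (by positivity) (by positivity) hn',
    Rcov_div β φ (by positivity) (by positivity) hn',
    Rcov_div β φ (by positivity) (by positivity) hn',
    Rcov_div β φ (by positivity) (by positivity) hn']
  simp only [Nat.cast_one, div_one]
  ring

lemma Rcov_add (β : ℝ) (φ : ℝ → ℝ) {s m : ℝ} (hs : 0 < s) (hm : 0 ≤ m) :
    Rcov β φ s (s + m) = s ^ (2 * β) * φ (1 + m / s) := by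
  unfold Rcov
  have h : ¬(s = 0 ∨ s + m = 0) := by
    rintro (h | h) <;> linarith
  rw [if_neg h, if_pos (by linarith), add_div, div_self hs.ne']

/-- If `φ(y) + λ (y-1)^α` has bounded derivative on `(1,2]`, then `φ(y)` is `φ(1) - λ (y-1)^α`
up to an error linear in `y - 1`. -/
lemma abs_sub_add_rpow_le {α lam M : ℝ} {φ : ℝ → ℝ} (hα : 0 < α)
    (hφc : ContinuousOn φ (Set.Ici 1)) (hφ2 : DifferentiableOn ℝ φ (Set.Ioi 1))
    (hM : ∀ x ∈ Set.Ioc (1 : ℝ) 2, |deriv (fun y => φ y + lam * (y - 1) ^ α) x| ≤ M)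
    {u : ℝ} (hu : 0 ≤ u) (hu1 : u ≤ 1) :
    |φ (1 + u) - φ 1 + lam * u ^ α| ≤ M * u := by
  rcases hu.eq_or_lt with rfl | hu
  · simp [Real.zero_rpow hα.ne']
  have hc : ContinuousOn (fun y => φ y + lam * (y - 1) ^ α) (Set.Icc 1 (1 + u)) := by
    refine (hφc.mono Set.Icc_subset_Ici_self).add (Continuous.continuousOn ?_)
    exact continuous_const.mul ((continuous_id.sub continuous_const).rpow_const
      fun _ => Or.inr hα.le)
  have hd : DifferentiableOn ℝ (fun y => φ y + lam * (y - 1) ^ α) (Set.Ioo 1 (1 + u)) := by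
    refine (hφ2.mono fun y hy => hy.1).add (DifferentiableOn.const_mul ?_ _)
    intro y hy
    refine DifferentiableWithinAt.rpow_const (by fun_prop) (Or.inl ?_)
    have := hy.1
    linarith
  obtain ⟨c, hc1, hc2⟩ := exists_deriv_eq_slope _ (by linarith : (1 : ℝ) < 1 + u) hc hd
  have h := hM c ⟨hc1.1, by linarith [hc1.2]⟩
  rw [hc2] at h
  simp only [sub_self, Real.zero_rpow hα.ne', add_sub_cancel_left, mul_zero, add_zero] at h
  rw [abs_div, abs_of_pos hu, div_le_iff₀ hu] at h
  rwa [show φ (1 + u) - φ 1 + lam * u ^ α = φ (1 + u) + lam * u ^ α - φ 1 by ring]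

lemma tendsto_Rcov_add {α β lam M : ℝ} {φ : ℝ → ℝ} (hα : 0 < α) (hα1 : α < 1)
    (hφc : ContinuousOn φ (Set.Ici 1)) (hφ2 : DifferentiableOn ℝ φ (Set.Ioi 1))
    (hM : ∀ x ∈ Set.Ioc (1 : ℝ) 2, |deriv (fun y => φ y + lam * (y - 1) ^ α) x| ≤ M)
    {m : ℝ} (hm : 0 ≤ m) :
    Tendsto (fun s : ℝ => (Rcov β φ s (s + m) - s ^ (2 * β) * φ 1) / s ^ (2 * β - α))
      atTop (𝓝 (-(lam * m ^ α))) := by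
  have h0 : Tendsto (fun s : ℝ => M * m * s ^ (-(1 - α))) atTop (𝓝 0) := by
    simpa using (tendsto_rpow_neg_atTop (by linarith : 0 < 1 - α)).const_mul (M * m)
  rw [tendsto_iff_norm_sub_tendsto_zero]
  refine squeeze_zero' (Eventually.of_forall fun _ => norm_nonneg _) ?_ h0
  filter_upwards [eventually_ge_atTop (max 1 m)] with s hs
  have hs1 : 1 ≤ s := (le_max_left _ _).trans hs
  have hsm : m ≤ s := (le_max_right _ _).trans hs
  have hs0 : 0 < s := by linarith
  have hsα : 0 < s ^ α := Real.rpow_pos_of_pos hs0 _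
  have hsβ : 0 < s ^ (2 * β) := Real.rpow_pos_of_pos hs0 _
  have key := abs_sub_add_rpow_le hα hφc hφ2 hM (u := m / s) (by positivity)
    ((div_le_one hs0).2 hsm)
  rw [Real.norm_eq_abs, Rcov_add β φ hs0 hm, Real.rpow_sub hs0]
  have e1 : (s ^ (2 * β) * φ (1 + m / s) - s ^ (2 * β) * φ 1) / (s ^ (2 * β) / s ^ α)
      - -(lam * m ^ α) = s ^ α * (φ (1 + m / s) - φ 1 + lam * (m / s) ^ α) := by
    rw [Real.div_rpow hm hs0.le]
    field_simp
    ring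
  have e2 : s ^ (-(1 - α)) = s ^ α / s := by
    rw [neg_sub, Real.rpow_sub hs0, Real.rpow_one]
  rw [e1, abs_mul, abs_of_pos hsα, e2]
  calc s ^ α * |φ (1 + m / s) - φ 1 + lam * (m / s) ^ α| ≤ s ^ α * (M * (m / s)) := by gcongr
    _ = M * m * (s ^ α / s) := by ring

lemma tendsto_nat_add_div_rpow (k : ℕ) (e : ℝ) :
    Tendsto (fun j : ℕ => ((j : ℝ) + k) ^ e / (j : ℝ) ^ e) atTop (𝓝 1) := by
  have h : Tendsto (fun j : ℕ => (1 + (k : ℝ) / j)) atTop (𝓝 1) := by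
    simpa using (tendsto_const_div_atTop_nhds_zero_nat (k : ℝ)).const_add 1
  have h2 := h.rpow_const (p := e) (Or.inl one_ne_zero)
  rw [Real.one_rpow] at h2
  refine h2.congr' ?_
  filter_upwards [eventually_gt_atTop 0] with j hj
  have : (0 : ℝ) < j := by exact_mod_cast hj
  rw [← Real.div_rpow (by positivity) this.le, add_div, div_self this.ne']

lemma tendsto_rpow_succ_sub (p : ℝ) :
    Tendsto (fun j : ℕ => (((j : ℝ) + 1) ^ p - (j : ℝ) ^ p) / (j : ℝ) ^ (p - 1))
      atTop (𝓝 p) := by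
  have hd : HasDerivAt (fun y : ℝ => y ^ p) p 1 := by
    simpa using Real.hasDerivAt_rpow_const (x := 1) (p := p) (Or.inl one_ne_zero)
  have h := hd.tendsto_slope_zero_right
  have hj : Tendsto (fun j : ℕ => ((j : ℝ))⁻¹) atTop (𝓝[>] 0) :=
    tendsto_inv_atTop_nhdsGT_zero.comp tendsto_natCast_atTop_atTop
  refine (h.comp hj).congr' ?_
  filter_upwards [eventually_gt_atTop 0] with j hj
  have hj : (0 : ℝ) < j := by exact_mod_cast hj
  have e : (j : ℝ) + 1 = j * (1 + (j : ℝ)⁻¹) := by field_simp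
  have hp : (0 : ℝ) < (j : ℝ) ^ p := Real.rpow_pos_of_pos hj _
  simp only [Function.comp_apply, inv_inv, Real.one_rpow, smul_eq_mul]
  rw [e, Real.mul_rpow hj.le (by positivity), Real.rpow_sub hj, Real.rpow_one]
  field_simp

/-- If `f j ~ c j^(p-1)` with `p > 0`, then `∑_{j<N} f j ~ (c/p) N^p`. -/
lemma tendsto_sum_range_div_rpow {f : ℕ → ℝ} {c p : ℝ} (hp : 0 < p)
    (hf : Tendsto (fun j : ℕ => f j / (j : ℝ) ^ (p - 1)) atTop (𝓝 c)) :
    Tendsto (fun N : ℕ => (∑ j ∈ Finset.range N, f j) / (N : ℝ) ^ p) atTop (𝓝 (c / p)) := by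
  set g : ℕ → ℝ := fun j => ((j : ℝ) + 1) ^ p - (j : ℝ) ^ p with hg
  have hsum : ∀ N : ℕ, ∑ j ∈ Finset.range N, g j = (N : ℝ) ^ p := by
    intro N
    have := Finset.sum_range_sub (fun j : ℕ => (j : ℝ) ^ p) N
    simpa [hg, Real.zero_rpow hp.ne'] using this
  have hgpos : ∀ j, 0 < g j := fun j =>
    sub_pos.2 (Real.rpow_lt_rpow (Nat.cast_nonneg j) (by linarith) hp)
  have hratio : Tendsto (fun j => f j / g j) atTop (𝓝 (c / p)) := by
    refine (hf.div (tendsto_rpow_succ_sub p) hp.ne').congr' ?_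
    filter_upwards [eventually_gt_atTop 0] with j hj
    have hj : (0 : ℝ) < j := by exact_mod_cast hj
    have := Real.rpow_pos_of_pos hj (p - 1)
    exact div_div_div_cancel_right₀ this.ne' _ _
  have ho : (fun j => f j - c / p * g j) =o[atTop] g := by
    rw [Asymptotics.isLittleO_iff_tendsto' (Eventually.of_forall
      fun j h => absurd h (hgpos j).ne')]
    have := hratio.sub_const (c / p)
    rw [sub_self] at this
    refine this.congr fun j => ?_
    have := (hgpos j).ne'
    field_simp
  have hNp : Tendsto (fun N : ℕ => (N : ℝ) ^ p) atTop atTop :=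
    (tendsto_rpow_atTop hp).comp tendsto_natCast_atTop_atTop
  have hs := ho.sum_range (fun j => (hgpos j).le) (by simpa only [hsum] using hNp)
  simp only [Finset.sum_sub_distrib, ← Finset.mul_sum, hsum] at hs
  have h := hs.tendsto_div_nhds_zero.add_const (c / p)
  rw [zero_add] at h
  refine h.congr' ?_
  filter_upwards [hNp.eventually_gt_atTop 0] with N hN
  field_simp
  ring

lemma tendsto_Dn_one {α β lam M : ℝ} {φ : ℝ → ℝ} (hα : 0 < α) (hα1 : α < 1)
    (hφc : ContinuousOn φ (Set.Ici 1)) (hφ2 : DifferentiableOn ℝ φ (Set.Ioi 1))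
    (hM : ∀ x ∈ Set.Ioc (1 : ℝ) 2, |deriv (fun y => φ y + lam * (y - 1) ^ α) x| ≤ M)
    (x : ℕ) :
    Tendsto (fun j : ℕ => Dn β φ 1 j (j + x) / (j : ℝ) ^ (2 * β - α))
      atTop (𝓝 (lam * rho α (x : ℤ))) := by
  set k : ℝ → ℝ → ℝ := fun m s => Rcov β φ s (s + m) - s ^ (2 * β) * φ 1 with hk
  have h0 : ∀ m : ℝ, 0 ≤ m → Tendsto (fun j : ℕ => k m j / (j : ℝ) ^ (2 * β - α))
      atTop (𝓝 (-(lam * m ^ α))) := fun m hm =>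
    (tendsto_Rcov_add hα hα1 hφc hφ2 hM hm).comp tendsto_natCast_atTop_atTop
  have h1 : ∀ m : ℝ, 0 ≤ m → Tendsto (fun j : ℕ => k m ((j : ℝ) + 1) / (j : ℝ) ^ (2 * β - α))
      atTop (𝓝 (-(lam * m ^ α))) := by
    intro m hm
    have ha := ((tendsto_add_atTop_iff_nat 1).2 (h0 m hm)).mul
      (tendsto_nat_add_div_rpow 1 (2 * β - α))
    rw [mul_one] at ha
    refine ha.congr fun j => ?_
    have : (0 : ℝ) < ((j : ℝ) + 1) ^ (2 * β - α) := by positivity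
    push_cast
    field_simp
  rcases x with _ | x
  · have h2 : Tendsto (fun j : ℕ => φ 1 * ((((j : ℝ) + 1) ^ (2 * β) - (j : ℝ) ^ (2 * β))
        / (j : ℝ) ^ (2 * β - α))) atTop (𝓝 0) := by
      have ha := (tendsto_rpow_succ_sub (2 * β)).mul
        ((tendsto_rpow_neg_atTop (by linarith : 0 < 1 - α)).comp tendsto_natCast_atTop_atTop)
      rw [mul_zero] at ha
      have hb := ha.const_mul (φ 1)
      rw [mul_zero] at hb
      refine hb.congr' ?_
      filter_upwards [eventually_gt_atTop 0] with j hj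
      have hj : (0 : ℝ) < j := by exact_mod_cast hj
      have e : (j : ℝ) ^ (2 * β - 1) = (j : ℝ) ^ (2 * β - α) * (j : ℝ) ^ (-(1 - α)) := by
        rw [← Real.rpow_add hj]
        congr 1
        ring
      have := Real.rpow_pos_of_pos hj (2 * β - α)
      have := Real.rpow_pos_of_pos hj (-(1 - α))
      simp only [Function.comp_apply]
      rw [e]
      field_simp
    have hT := (((h1 0 le_rfl).sub ((h0 1 zero_le_one).const_mul 2)).add (h0 0 le_rfl)).add h2
    convert hT using 1
    · funext j
      simp only [hk, Dn, Nat.cast_one, div_one, add_zero]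
      rw [Rcov_comm β φ ((j : ℝ) + 1) j]
      ring
    · simp [rho, Real.zero_rpow hα.ne']
      ring
  · have hx : (0 : ℝ) ≤ x := Nat.cast_nonneg x
    have hT := (((h1 (x + 1) (by positivity)).sub (h1 x hx)).sub
      (h0 (x + 2) (by positivity))).add (h0 (x + 1) (by positivity))
    convert hT using 1
    · funext j
      simp only [hk, Dn, Nat.cast_one, div_one, Nat.cast_add]
      rw [show (j : ℝ) + 1 + (x + 1) = j + (x + 1) + 1 by ring,
        show (j : ℝ) + 1 + x = j + (x + 1) by ring,
        show (j : ℝ) + (x + 2) = j + (x + 1) + 1 by ring]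
      ring
    · simp only [rho, Nat.cast_add, Nat.cast_one, Int.cast_add, Int.cast_natCast, Int.cast_one,
        add_sub_cancel_right]
      rw [abs_of_nonneg hx, abs_of_nonneg (by positivity : (0 : ℝ) ≤ x + 1),
        abs_of_nonneg (by positivity : (0 : ℝ) ≤ x + 1 + 1),
        show (x : ℝ) + 1 + 1 = x + 2 by ring]
      congr 1
      ring

theorem stmt_12 (α β lam ν C₁ C₂ : ℝ) (φ : ℝ → ℝ) (ℓ r : ℕ) (hℓ : 1 ≤ ℓ)
    (hαℓ : α = 1 / (2 * (ℓ : ℝ) + 1)) (hr : r < ℓ)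
    (hα : 0 < α) (hα1 : α < 1) (hβ : 0 < β) (hβ2 : β ≤ 1 / 2) (hαβ : α ≤ 2 * β)
    (hφc : ContinuousOn φ (Set.Ici 1)) (hφ2 : ContDiffOn ℝ 2 φ (Set.Ioi 1))
    (hlam : 0 < lam)
    (hH1 : ∃ M : ℝ, ∀ x ∈ Set.Ioc (1 : ℝ) 2,
      |deriv (fun y => φ y + lam * (y - 1) ^ α) x| ≤ M)
    (hC₁ : 0 < C₁) (hC₂ : 0 < C₂) (hν : 1 < ν) (hν2 : ν ≤ 2)
    (hH2a : ∀ x ∈ Set.Ioc (1 : ℝ) 2, |iteratedDeriv 2 φ x| ≤ C₁ * (x - 1) ^ (α - 2))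
    (hH2b : ∀ x ∈ Set.Ioi (2 : ℝ), |iteratedDeriv 2 φ x| ≤ C₂ * x ^ (-ν - 1))
    (hpos : ∀ n j : ℕ, 0 ≤ Dn β φ n j j) :
    ∀ t : ℝ, 0 < t → ∀ x : ℕ,
      Filter.Tendsto (fun n : ℕ =>
          ∑ j ∈ Finset.range (⌊(n : ℝ) * t⌋₊ - x),
            (Dn β φ n j j) ^ r * (Dn β φ n (j + x) (j + x)) ^ r
              * (Dn β φ n j (j + x)) ^ (2 * (ℓ - r) + 1))
        Filter.atTop
        (nhds (α / (2 * β) * 2 ^ (2 * ℓ + 1 - (2 * (ℓ - r) + 1)) * lam ^ (2 * ℓ + 1)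
          * t ^ (2 * β / α) * rho α (x : ℤ) ^ (2 * (ℓ - r) + 1))) := by
  intro t ht x
  obtain ⟨M, hM⟩ := hH1
  have hφd : DifferentiableOn ℝ φ (Set.Ioi 1) := hφ2.differentiableOn (by norm_num)
  have hD := tendsto_Dn_one (β := β) hα hα1 hφc hφd hM
  set p : ℝ := 2 * β / α with hp
  have hp0 : 0 < p := by positivity
  have hαinv : α * (2 * ℓ + 1) = 1 := by
    rw [hαℓ]
    field_simp
  have hpℓ : p = 2 * β * (2 * ℓ + 1) := by
    rw [hp, div_eq_iff hα.ne', mul_assoc, mul_comm _ α, hαinv, mul_one]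
  have hexp : r + r + (2 * (ℓ - r) + 1) = 2 * ℓ + 1 := by omega
  have hexp2 : 2 * ℓ + 1 - (2 * (ℓ - r) + 1) = r + r := by omega
  have hpow : ∀ y e : ℝ, 0 ≤ y → y ^ (e * (2 * ℓ + 1))
      = (y ^ e) ^ r * (y ^ e) ^ r * (y ^ e) ^ (2 * (ℓ - r) + 1) := by
    intro y e hy
    rw [← pow_add, ← pow_add, hexp, ← Real.rpow_mul_natCast hy]
    push_cast
    rfl
  have hshift : Tendsto (fun j : ℕ => Dn β φ 1 (j + x) (j + x) / (j : ℝ) ^ (2 * β - α))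
      atTop (𝓝 (lam * rho α ((0 : ℕ) : ℤ))) := by
    have ha := ((tendsto_add_atTop_iff_nat x).2 (hD 0)).mul
      (tendsto_nat_add_div_rpow x (2 * β - α))
    rw [mul_one] at ha
    refine ha.congr' ?_
    filter_upwards [eventually_gt_atTop 0] with j hj
    have hj : (0 : ℝ) < j := by exact_mod_cast hj
    have : (0 : ℝ) < ((j : ℝ) + x) ^ (2 * β - α) := by positivity
    push_cast
    simp only [add_zero]
    field_simp
  set f : ℕ → ℝ := fun j => (Dn β φ 1 j j) ^ r * (Dn β φ 1 (j + x) (j + x)) ^ r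
    * (Dn β φ 1 j (j + x)) ^ (2 * (ℓ - r) + 1) with hf
  have hft := tendsto_sum_range_div_rpow (f := f) hp0
    ((((hD 0).pow r).mul (hshift.pow r)).mul ((hD x).pow (2 * (ℓ - r) + 1)) |>.congr fun j => by
      rw [show p - 1 = (2 * β - α) * (2 * ℓ + 1) by rw [sub_mul, hαinv, hpℓ],
        hpow _ _ (Nat.cast_nonneg j), hf]
      simp only [div_pow, add_zero]
      rw [div_mul_div_comm, div_mul_div_comm])
  have hfloor : Tendsto (fun n : ℕ => ⌊(n : ℝ) * t⌋₊ - x) atTop atTop :=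
    (tendsto_sub_atTop_nat x).comp (tendsto_nat_floor_atTop.comp
      (tendsto_natCast_atTop_atTop.atTop_mul_const ht))
  have hlim : Tendsto (fun n : ℕ => ((⌊(n : ℝ) * t⌋₊ - x : ℕ) : ℝ) / n) atTop (𝓝 t) := by
    have ha := ((tendsto_nat_floor_mul_div_atTop ht.le).comp
      (tendsto_natCast_atTop_atTop (R := ℝ))).sub
      (tendsto_const_div_atTop_nhds_zero_nat (x : ℝ))
    rw [sub_zero] at ha
    refine ha.congr' ?_
    filter_upwards [hfloor.eventually_gt_atTop 0] with n hn
    rw [Nat.cast_sub (by omega), sub_div]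
    simp [mul_comm]
  have hmain := (hft.comp hfloor).mul (hlim.rpow_const (p := p) (Or.inr hp0.le))
  convert hmain.congr' ?_ using 1
  · congr 1
    have hρ0 : rho α ((0 : ℕ) : ℤ) = 2 := by
      simp [rho, Real.zero_rpow hα.ne']
      norm_num
    rw [hρ0, hexp2, ← hexp, hp]
    generalize rho α (x : ℤ) = ρ
    simp only [mul_pow, pow_add]
    field_simp
  · filter_upwards [hfloor.eventually_gt_atTop 0, eventually_gt_atTop 0] with n hn hn0
    have hn' : (0 : ℝ) < n := by exact_mod_cast hn0
    have hN : (0 : ℝ) < ((⌊(n : ℝ) * t⌋₊ - x : ℕ) : ℝ) := by exact_mod_cast hn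
    have hNp := Real.rpow_pos_of_pos hN p
    have hnp := Real.rpow_pos_of_pos hn' p
    have e : ∀ j, (Dn β φ n j j) ^ r * (Dn β φ n (j + x) (j + x)) ^ r
        * (Dn β φ n j (j + x)) ^ (2 * (ℓ - r) + 1) = (n : ℝ) ^ (-p) * f j := by
      intro j
      rw [Dn_eq_rpow_mul β φ hn0 j j, Dn_eq_rpow_mul β φ hn0 (j + x) (j + x),
        Dn_eq_rpow_mul β φ hn0 j (j + x), hpℓ, ← neg_mul (2 * β), hpow _ _ hn'.le, hf]
      simp only [mul_pow]
      ring
    simp only [e, ← Finset.mul_sum, Function.comp_apply]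
    rw [Real.div_rpow hN.le hn'.le, Real.rpow_neg hn'.le]
    field_simp
end

section
/- Under hypothesis (H.1), the unit-spacing increment variance satisfies lim_{j→∞} (j+1)^{α−2β} D_1(j,j) = 2λ, where D_1(j,j) = (j+1)^{2β} φ(1) + j^{2β} φ(1) − 2 j^{2β} φ((j+1)/j) equals E[(X_{j+1} − X_j)^2] for the process X with covariance R. -/
open Real Filter Finset Topology

/-- For `0 ≤ p ≤ 1`, the increment of `x ↦ x ^ p` at `n`, rescaled by `(n + 1) ^ (α - p)` with
`α < 1`, tends to zero. -/
theorem tendsto_rpow_mul_one_sub_rpow_div {α p : ℝ} (hα1 : α < 1) (hp : 0 ≤ p) (hp1 : p ≤ 1) :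
    Tendsto (fun j : ℕ => ((j : ℝ) + 1) ^ α * (1 - ((j : ℝ) / (j + 1)) ^ p)) atTop (𝓝 0) := by
  have hlim : Tendsto (fun j : ℕ => ((j : ℝ) + 1) ^ (-(1 - α))) atTop (𝓝 0) :=
    (tendsto_rpow_neg_atTop (by linarith)).comp
      (tendsto_atTop_add_const_right _ _ tendsto_natCast_atTop_atTop)
  refine squeeze_zero (fun j => ?_) (fun j => ?_) hlim
  · have h1 : ((j : ℝ) / (j + 1)) ≤ 1 := by
      rw [div_le_one (by positivity)]; linarith
    have h2 : ((j : ℝ) / (j + 1)) ^ p ≤ 1 := Real.rpow_le_one (by positivity) h1 hp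
    exact mul_nonneg (by positivity) (by linarith)
  · have hN : (0 : ℝ) < (j : ℝ) + 1 := by positivity
    have h1 : ((j : ℝ) / (j + 1)) ≤ 1 := by
      rw [div_le_one (by positivity)]; linarith
    have h2 : (j : ℝ) / (j + 1) ≤ ((j : ℝ) / (j + 1)) ^ p := by
      rcases eq_or_lt_of_le (show (0 : ℝ) ≤ (j : ℝ) / (j + 1) by positivity) with h | h
      · rw [← h]; exact Real.rpow_nonneg le_rfl _
      · simpa using Real.rpow_le_rpow_of_exponent_ge h h1 hp1
    calc ((j : ℝ) + 1) ^ α * (1 - ((j : ℝ) / (j + 1)) ^ p)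
        ≤ ((j : ℝ) + 1) ^ α * (1 - (j : ℝ) / (j + 1)) := by gcongr
      _ = ((j : ℝ) + 1) ^ α / ((j : ℝ) + 1) := by field_simp; ring
      _ = ((j : ℝ) + 1) ^ (-(1 - α)) := by
        rw [neg_sub, Real.rpow_sub_one hN.ne']

theorem tendsto_div_add_one_rpow (p : ℝ) :
    Tendsto (fun j : ℕ => ((j : ℝ) / (j + 1)) ^ p) atTop (𝓝 1) := by
  simpa using (tendsto_natCast_div_add_atTop (1 : ℝ)).rpow_const (p := p) (Or.inl one_ne_zero)

/-- If `ψ` is continuous on `[1, 2]` with bounded derivative on `(1, 2]`, then its increments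
`ψ (1 + 1 / j) - ψ 1` are `o(j ^ (-α))` for every `α < 1`. -/
theorem tendsto_rpow_mul_increment {α M : ℝ} {ψ : ℝ → ℝ} (hα1 : α < 1)
    (hc : ContinuousOn ψ (Set.Icc 1 2)) (hd : DifferentiableOn ℝ ψ (Set.Ioo 1 2))
    (hM : ∀ x ∈ Set.Ioc (1 : ℝ) 2, |deriv ψ x| ≤ M) :
    Tendsto (fun j : ℕ => (j : ℝ) ^ α * (ψ (((j : ℝ) + 1) / j) - ψ 1)) atTop (𝓝 0) := by
  have hlim : Tendsto (fun j : ℕ => M * (j : ℝ) ^ (-(1 - α))) atTop (𝓝 0) := by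
    simpa using ((tendsto_rpow_neg_atTop (by linarith : 0 < 1 - α)).comp
      tendsto_natCast_atTop_atTop).const_mul M
  refine squeeze_zero_norm' ?_ hlim
  filter_upwards [eventually_ge_atTop 1] with j hj
  have hj1 : (1 : ℝ) ≤ j := by exact_mod_cast hj
  have hj0 : (0 : ℝ) < j := by linarith
  have hx1 : 1 < ((j : ℝ) + 1) / j := by rw [lt_div_iff₀ hj0]; linarith
  have hx2 : ((j : ℝ) + 1) / j ≤ 2 := by rw [div_le_iff₀ hj0]; linarith
  obtain ⟨c, hcm, hceq⟩ := exists_deriv_eq_slope ψ hx1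
    (hc.mono (Set.Icc_subset_Icc_right hx2)) (hd.mono (Set.Ioo_subset_Ioo_right hx2))
  have hcM := hM c ⟨hcm.1, hcm.2.le.trans hx2⟩
  have hsub : ((j : ℝ) + 1) / j - 1 = 1 / j := by field_simp; ring
  have hdiff : ψ (((j : ℝ) + 1) / j) - ψ 1 = deriv ψ c / j := by
    rw [hceq, hsub]; field_simp
  rw [hdiff, norm_mul, norm_div, Real.norm_eq_abs, Real.norm_eq_abs, Real.norm_eq_abs,
    abs_of_pos hj0, abs_of_pos (Real.rpow_pos_of_pos hj0 α), neg_sub, Real.rpow_sub_one hj0.ne']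
  calc (j : ℝ) ^ α * (|deriv ψ c| / j) ≤ (j : ℝ) ^ α * (M / j) := by gcongr
    _ = M * ((j : ℝ) ^ α / j) := by ring

/-- The increment variance at unit spacing, in terms of `φ`. -/
theorem Dn_one_self (β : ℝ) (φ : ℝ → ℝ) {j : ℕ} (hj : 1 ≤ j) :
    Dn β φ 1 j j = ((j : ℝ) + 1) ^ (2 * β) * φ 1 + (j : ℝ) ^ (2 * β) * φ 1
      - 2 * (j : ℝ) ^ (2 * β) * φ (((j : ℝ) + 1) / j) := by
  have hj0 : (j : ℝ) ≠ 0 := by positivity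
  have hN : (j : ℝ) + 1 ≠ 0 := by positivity
  have hlt : ¬ (1 : ℝ) ≤ 0 := by norm_num
  simp [Dn, Rcov, hj0, hN, hlt]
  ring

theorem stmt_13 (α β lam : ℝ) (φ : ℝ → ℝ)
    (hα : 0 < α) (hα1 : α < 1) (hβ : 0 < β) (hβ2 : β ≤ 1 / 2) (hαβ : α ≤ 2 * β)
    (hφc : ContinuousOn φ (Set.Ici 1)) (hφ2 : ContDiffOn ℝ 2 φ (Set.Ioi 1))
    (hlam : 0 < lam)
    (hH1 : ∃ M : ℝ, ∀ x ∈ Set.Ioc (1 : ℝ) 2,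
      |deriv (fun y => φ y + lam * (y - 1) ^ α) x| ≤ M)
    :
    Filter.Tendsto (fun j : ℕ => ((j : ℝ) + 1) ^ (α - 2 * β) * Dn β φ 1 j j)
      Filter.atTop (nhds (2 * lam)) := by
  obtain ⟨M, hM⟩ := hH1
  set ψ : ℝ → ℝ := fun y => φ y + lam * (y - 1) ^ α with hψ
  have hcont : ContinuousOn ψ (Set.Icc 1 2) := by
    refine (hφc.mono Set.Icc_subset_Ici_self).add (continuousOn_const.mul ?_)
    exact (continuousOn_id.sub continuousOn_const).rpow_const fun _ _ => Or.inr hα.le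
  have hdiff : DifferentiableOn ℝ ψ (Set.Ioo 1 2) := by
    refine ((hφ2.differentiableOn (by norm_num)).mono Set.Ioo_subset_Ioi_self).add
      ((DifferentiableOn.rpow_const (differentiableOn_id.sub_const 1) fun x hx =>
        Or.inl ?_).const_mul lam)
    exact (sub_pos.2 hx.1).ne'
  have hpow := tendsto_div_add_one_rpow (2 * β - α)
  have hlim := (((tendsto_rpow_mul_one_sub_rpow_div hα1 (by linarith : 0 ≤ 2 * β)
    (by linarith)).const_mul (φ 1)).sub
    ((hpow.mul (tendsto_rpow_mul_increment hα1 hcont hdiff hM)).const_mul 2)).add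
    (hpow.const_mul (2 * lam))
  simp only [mul_zero, sub_zero, zero_add, mul_one] at hlim
  refine hlim.congr' ?_
  filter_upwards [eventually_ge_atTop 1] with j hj
  have hj0 : (0 : ℝ) < j := by exact_mod_cast hj
  have hN : (0 : ℝ) < (j : ℝ) + 1 := by positivity
  have hsub : ((j : ℝ) + 1) / j - 1 = (j : ℝ)⁻¹ := by field_simp; ring
  have hψ1 : ψ 1 = φ 1 := by simp [hψ, Real.zero_rpow hα.ne']
  have hψj : ψ (((j : ℝ) + 1) / j) = φ (((j : ℝ) + 1) / j) + lam * ((j : ℝ) ^ α)⁻¹ := by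
    simp only [hψ, hsub, Real.inv_rpow hj0.le]
  rw [Dn_one_self β φ hj, hψ1, hψj, Real.div_rpow hj0.le hN.le, Real.div_rpow hj0.le hN.le,
    Real.rpow_sub hj0, Real.rpow_sub hN, Real.rpow_sub hN]
  have h1 : (j : ℝ) ^ α ≠ 0 := (Real.rpow_pos_of_pos hj0 _).ne'
  have h2 : ((j : ℝ) + 1) ^ α ≠ 0 := (Real.rpow_pos_of_pos hN _).ne'
  have h3 : ((j : ℝ) + 1) ^ (2 * β) ≠ 0 := (Real.rpow_pos_of_pos hN _).ne'
  generalize φ (((j : ℝ) + 1) / j) = u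
  field_simp
  ring
end

section
/- Under hypothesis (H.1), for every fixed integer x ≥ 1 one has lim_{j→∞} (j+1)^{α−2β} D_1(j, j+x) = −λ (2x^{α} − (x−1)^{α} − (x+1)^{α}) = λ ((x+1)^{α} + (x−1)^{α} − 2x^{α}), where D_1(j, j+x) = E[(X_{j+1} − X_j)(X_{j+x+1} − X_{j+x})] for the process X with covariance R. -/
open Real Filter Finset Topology

/-- A function that is continuous on `[1, ∞)`, differentiable on `(1, ∞)` and has derivative bounded
by `M` on `(1, 2]` is `M`-Lipschitz on `[1, 2]`. -/
theorem abs_sub_le_of_abs_deriv_le_Ioc {ψ : ℝ → ℝ} {M : ℝ} (hc : ContinuousOn ψ (Set.Ici 1))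
    (hd : DifferentiableOn ℝ ψ (Set.Ioi 1)) (hM : ∀ x ∈ Set.Ioc (1 : ℝ) 2, |deriv ψ x| ≤ M)
    {a b : ℝ} (ha : 1 ≤ a) (hab : a < b) (hb : b ≤ 2) : |ψ b - ψ a| ≤ M * (b - a) := by
  obtain ⟨c, hc', h⟩ := exists_deriv_eq_slope ψ hab
    (hc.mono fun y hy => ha.trans hy.1) (hd.mono fun y hy => ha.trans_lt hy.1)
  have hpos : 0 < b - a := sub_pos.2 hab
  have hbd := hM c ⟨ha.trans_lt hc'.1, hc'.2.le.trans hb⟩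
  rwa [h, abs_div, abs_of_pos hpos, div_le_iff₀ hpos] at hbd

/-- The covariance above the diagonal, with the singular part of `φ` at `1` split off. -/
theorem Rcov_eq_regular_sub_singular {α β lam : ℝ} {φ : ℝ → ℝ} {s t : ℝ} (hs : 0 < s)
    (hst : s ≤ t) :
    Rcov β φ s t = s ^ (2 * β) * (φ (t / s) + lam * (t / s - 1) ^ α)
      - lam * s ^ (2 * β - α) * (t - s) ^ α := by
  have h : t / s - 1 = (t - s) / s := by field_simp
  rw [Rcov, if_neg (by simp [hs.ne', (hs.trans_le hst).ne']), if_pos hst, h,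
    div_rpow (sub_nonneg.2 hst) hs.le, rpow_sub hs]
  ring


theorem stmt_14 (α β lam : ℝ) (φ : ℝ → ℝ)
    (hα : 0 < α) (hα1 : α < 1) (hβ : 0 < β) (hβ2 : β ≤ 1 / 2) (hαβ : α ≤ 2 * β)
    (hφc : ContinuousOn φ (Set.Ici 1)) (hφ2 : ContDiffOn ℝ 2 φ (Set.Ioi 1))
    (hlam : 0 < lam)
    (hH1 : ∃ M : ℝ, ∀ x ∈ Set.Ioc (1 : ℝ) 2,
      |deriv (fun y => φ y + lam * (y - 1) ^ α) x| ≤ M)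
    :
    ∀ x : ℕ, 1 ≤ x →
      Filter.Tendsto (fun j : ℕ => ((j : ℝ) + 1) ^ (α - 2 * β) * Dn β φ 1 j (j + x))
        Filter.atTop
        (nhds (lam * (((x : ℝ) + 1) ^ α + ((x : ℝ) - 1) ^ α - 2 * (x : ℝ) ^ α))) := by
  intro x hx
  obtain ⟨M, hM⟩ := hH1
  have hx' : (1 : ℝ) ≤ x := by exact_mod_cast hx
  set ψ : ℝ → ℝ := fun y => φ y + lam * (y - 1) ^ α with hψ
  have hψc : ContinuousOn ψ (Set.Ici 1) :=
    hφc.add (continuousOn_const.mul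
      ((continuousOn_id.sub continuousOn_const).rpow_const fun _ _ => Or.inr hα.le))
  have hψd : DifferentiableOn ℝ ψ (Set.Ioi 1) := by
    refine (hφ2.differentiableOn (by norm_num)).add (DifferentiableOn.const_mul ?_ lam)
    exact (differentiableOn_id.sub_const 1).rpow_const fun y hy =>
      Or.inl (sub_pos.2 (Set.mem_Ioi.1 hy)).ne'
  have hM0 : 0 ≤ M := (abs_nonneg _).trans (hM 2 (by norm_num))
  have hratio : Tendsto (fun j : ℕ => ((j : ℝ) / ((j : ℝ) + 1)) ^ (2 * β - α)) atTop (𝓝 1) := by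
    simpa using (tendsto_natCast_div_add_atTop (1 : ℝ)).rpow_const
      (Or.inl one_ne_zero) (p := 2 * β - α)
  have hmain : Tendsto (fun j : ℕ => lam * (((x : ℝ) - 1) ^ α - (x : ℝ) ^ α)
      + ((j : ℝ) / ((j : ℝ) + 1)) ^ (2 * β - α) * (lam * (((x : ℝ) + 1) ^ α - (x : ℝ) ^ α))) atTop
      (𝓝 (lam * (((x : ℝ) + 1) ^ α + ((x : ℝ) - 1) ^ α - 2 * (x : ℝ) ^ α))) := by
    convert (hratio.mul_const (lam * (((x : ℝ) + 1) ^ α - (x : ℝ) ^ α))).const_add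
      (lam * (((x : ℝ) - 1) ^ α - (x : ℝ) ^ α)) using 2
    ring
  have herr : Tendsto (fun j : ℕ => 3 * M * ((j : ℝ) + 1) ^ (α - 1)) atTop (𝓝 0) := by
    have h := (tendsto_rpow_neg_atTop (sub_pos.2 hα1)).comp
      (tendsto_atTop_add_const_right atTop (1 : ℝ) tendsto_natCast_atTop_atTop)
    simpa [Function.comp_def] using h.const_mul (3 * M)
  refine tendsto_of_tendsto_of_dist hmain (squeeze_zero' (Eventually.of_forall fun _ => dist_nonneg)
    ?_ herr)
  filter_upwards [eventually_ge_atTop (x + 1)] with j hj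
  have hjx : (x : ℝ) + 1 ≤ j := by exact_mod_cast hj
  have hj0 : (0 : ℝ) < j := by linarith
  have hj1 : (0 : ℝ) < (j : ℝ) + 1 := by linarith
  set E₁ := ψ (((j : ℝ) + x + 1) / (j + 1)) - ψ (((j : ℝ) + x) / (j + 1)) with hE₁
  set E₂ := ψ (((j : ℝ) + x + 1) / j) - ψ (((j : ℝ) + x) / j) with hE₂
  have hb₁ : |E₁| ≤ M * (1 / ((j : ℝ) + 1)) := by
    refine (abs_sub_le_of_abs_deriv_le_Ioc hψc hψd hM ?_ ?_ ?_).trans_eq ?_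
    · rw [le_div_iff₀ hj1]; linarith
    · exact div_lt_div_of_pos_right (lt_add_one _) hj1
    · rw [div_le_iff₀ hj1]; linarith
    · field_simp; ring
  have hb₂ : |E₂| ≤ M * (1 / (j : ℝ)) := by
    refine (abs_sub_le_of_abs_deriv_le_Ioc hψc hψd hM ?_ ?_ ?_).trans_eq ?_
    · rw [le_div_iff₀ hj0]; linarith
    · exact div_lt_div_of_pos_right (lt_add_one _) hj0
    · rw [div_le_iff₀ hj0]; linarith
    · field_simp; ring
  have hD : Dn β φ 1 j (j + x) = ((j : ℝ) + 1) ^ (2 * β) * E₁ - (j : ℝ) ^ (2 * β) * E₂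
      + ((j : ℝ) + 1) ^ (2 * β - α) * (lam * (((x : ℝ) - 1) ^ α - (x : ℝ) ^ α))
      + (j : ℝ) ^ (2 * β - α) * (lam * (((x : ℝ) + 1) ^ α - (x : ℝ) ^ α)) := by
    simp only [Dn, Nat.cast_one, div_one, Nat.cast_add]
    rw [Rcov_eq_regular_sub_singular (α := α) (lam := lam) hj1 (t := (j : ℝ) + x + 1) (by linarith),
      Rcov_eq_regular_sub_singular (α := α) (lam := lam) hj1 (t := (j : ℝ) + x) (by linarith),
      Rcov_eq_regular_sub_singular (α := α) (lam := lam) hj0 (t := (j : ℝ) + x + 1) (by linarith),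
      Rcov_eq_regular_sub_singular (α := α) (lam := lam) hj0 (t := (j : ℝ) + x) (by linarith),
      show (j : ℝ) + x + 1 - (j + 1) = x by ring, show (j : ℝ) + x - (j + 1) = x - 1 by ring,
      show (j : ℝ) + x + 1 - j = x + 1 by ring, show (j : ℝ) + x - j = x by ring, hE₁, hE₂]
    simp only [hψ]
    ring
  have hp₁ : ((j : ℝ) + 1) ^ (α - 2 * β) * ((j : ℝ) + 1) ^ (2 * β) = ((j : ℝ) + 1) ^ α := by
    rw [← rpow_add hj1]; ring_nf
  have hp₂ : ((j : ℝ) + 1) ^ (α - 2 * β) * ((j : ℝ) + 1) ^ (2 * β - α) = 1 := by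
    rw [← rpow_add hj1]; simp
  have hp₃ : ((j : ℝ) + 1) ^ (α - 2 * β) * (j : ℝ) ^ (2 * β - α)
      = ((j : ℝ) / ((j : ℝ) + 1)) ^ (2 * β - α) := by
    rw [div_rpow hj0.le hj1.le, eq_div_iff (rpow_pos_of_pos hj1 _).ne', mul_right_comm, hp₂,
      one_mul]
  have hp₄ : ((j : ℝ) + 1) ^ (α - 2 * β) * (j : ℝ) ^ (2 * β) ≤ ((j : ℝ) + 1) ^ α := by
    rw [← hp₁]
    gcongr
    linarith
  have hp₅ : ((j : ℝ) + 1) ^ (α - 1) = ((j : ℝ) + 1) ^ α * (1 / ((j : ℝ) + 1)) := by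
    rw [rpow_sub_one hj1.ne']; ring
  have hinv : 1 / (j : ℝ) ≤ 2 * (1 / ((j : ℝ) + 1)) := by
    rw [mul_one_div, div_le_div_iff₀ hj0 hj1]; linarith
  have hq : 0 ≤ ((j : ℝ) + 1) ^ (α - 2 * β) * (j : ℝ) ^ (2 * β) := by positivity
  rw [dist_comm, Real.dist_eq]
  calc _ = |((j : ℝ) + 1) ^ α * E₁
        - ((j : ℝ) + 1) ^ (α - 2 * β) * (j : ℝ) ^ (2 * β) * E₂| := by
        rw [hD, ← hp₁, ← hp₃]
        congr 1
        linear_combination (lam * (((x : ℝ) - 1) ^ α - (x : ℝ) ^ α)) * hp₂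
    _ ≤ ((j : ℝ) + 1) ^ α * |E₁|
        + ((j : ℝ) + 1) ^ (α - 2 * β) * (j : ℝ) ^ (2 * β) * |E₂| := by
        refine (abs_sub _ _).trans_eq ?_
        rw [abs_mul, abs_mul, abs_of_nonneg hq, abs_of_nonneg (by positivity)]
    _ ≤ ((j : ℝ) + 1) ^ α * (M * (1 / ((j : ℝ) + 1)))
        + ((j : ℝ) + 1) ^ α * (M * (2 * (1 / ((j : ℝ) + 1)))) := by
        gcongr
        exact hb₂.trans (by gcongr)
    _ = _ := by rw [hp₅]; ring
end
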